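/- There exists a constant c > 0 such that for all n, M ≥ 1, every type promise T ⊆ [M]^n, and every partial function f : T → Bool, the zero-error randomized query complexity satisfies R_0(f) ≥ c · min(D(f)^{1/2}, n^{1/4}); consequently R_0(f) ≥ c · D(f)^{1/4}. -/

import Mathlib

open scoped Classical

namespace QCPaper

/-- A partial assignment `c` is consistent with the input `x` if it agrees with `x`
wherever it is defined. -/
def Consistent {n M : ℕ} (c : Fin n → Option (Fin M)) (x : Fin n → Fin M) : Prop :=
  ∀ i : Fin n, ∀ a : Fin M, c i = some a → x i = a

/-- The size of a partial assignment: the number of indices where it is defined. -/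
def paSize {n M : ℕ} (c : Fin n → Option (Fin M)) : ℕ :=
  (Finset.univ.filter fun i => c i ≠ none).card

/-- `c` is a certificate for the partial function `f` with promise `X`:
all inputs in `X` consistent with `c` get the same value under `f`. -/
def IsCertificate {n M : ℕ} (X : Set (Fin n → Fin M)) (f : (Fin n → Fin M) → Bool)
    (c : Fin n → Option (Fin M)) : Prop :=
  ∀ x ∈ X, ∀ y ∈ X, Consistent c x → Consistent c y → f x = f y

/-- The certificate complexity of `f` at the input `x`:
the least size of a certificate for `f` consistent with `x`. -/
noncomputable def Cx {n M : ℕ} (X : Set (Fin n → Fin M)) (f : (Fin n → Fin M) → Bool)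
    (x : Fin n → Fin M) : ℕ :=
  sInf {k | ∃ c : Fin n → Option (Fin M),
    IsCertificate X f c ∧ Consistent c x ∧ paSize c = k}

/-- The certificate complexity `C(f)`: the maximum of `Cx` over inputs in the promise. -/
noncomputable def certC {n M : ℕ} (X : Set (Fin n → Fin M))
    (f : (Fin n → Fin M) → Bool) : ℕ :=
  sSup {k | ∃ x ∈ X, Cx X f x = k}

/-- `b` is a sensitive block of `x` for `f` (with promise `X`). -/
def SensBlock {n M : ℕ} (X : Set (Fin n → Fin M)) (f : (Fin n → Fin M) → Bool)
    (x : Fin n → Fin M) (b : Finset (Fin n)) : Prop :=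
  ∃ y ∈ X, f y ≠ f x ∧ ∀ i : Fin n, y i ≠ x i → i ∈ b

/-- The block sensitivity of `f` at `x`: the largest number of pairwise disjoint
sensitive blocks of `x`. -/
noncomputable def bsx {n M : ℕ} (X : Set (Fin n → Fin M)) (f : (Fin n → Fin M) → Bool)
    (x : Fin n → Fin M) : ℕ :=
  sSup {m | ∃ b : Fin m → Finset (Fin n),
    (∀ j, SensBlock X f x (b j)) ∧ ∀ j j', j ≠ j' → Disjoint (b j) (b j')}

/-- The block sensitivity `bs(f)`. -/
noncomputable def bs {n M : ℕ} (X : Set (Fin n → Fin M))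
    (f : (Fin n → Fin M) → Bool) : ℕ :=
  sSup {m | ∃ x ∈ X, bsx X f x = m}

/-- The sensitivity of `f` at `x`: the largest number of pairwise disjoint
sensitive blocks of `x`, each of size 2. -/
noncomputable def sx {n M : ℕ} (X : Set (Fin n → Fin M)) (f : (Fin n → Fin M) → Bool)
    (x : Fin n → Fin M) : ℕ :=
  sSup {m | ∃ b : Fin m → Finset (Fin n),
    (∀ j, SensBlock X f x (b j) ∧ (b j).card = 2) ∧ ∀ j j', j ≠ j' → Disjoint (b j) (b j')}

/-- The sensitivity `s(f)`. -/
noncomputable def sens {n M : ℕ} (X : Set (Fin n → Fin M))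
    (f : (Fin n → Fin M) → Bool) : ℕ :=
  sSup {m | ∃ x ∈ X, sx X f x = m}

/-- The type of an input: the multiset of its entries. -/
def typeOf {n M : ℕ} (x : Fin n → Fin M) : Multiset (Fin M) :=
  Finset.univ.val.map x

/-- The multiplicity of the alphabet element `a` in the input `x`. -/
def mult {n M : ℕ} (x : Fin n → Fin M) (a : Fin M) : ℕ :=
  (Finset.univ.filter fun i => x i = a).card

/-- A type promise: the (nonempty) set of all strings with one fixed type. -/
def IsTypePromise {n M : ℕ} (T : Set (Fin n → Fin M)) : Prop :=
  ∃ x₀ : Fin n → Fin M, T = {x | typeOf x = typeOf x₀}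

/-- Decision trees over `[M]^n`: either a leaf with a Boolean answer, or a query
to an index together with a subtree for each possible answer. -/
inductive DTree (n M : ℕ) : Type
  | leaf : Bool → DTree n M
  | node : Fin n → (Fin M → DTree n M) → DTree n M

/-- Evaluation of a decision tree on an input. -/
def DTree.eval {n M : ℕ} : DTree n M → (Fin n → Fin M) → Bool
  | .leaf b, _ => b
  | .node i ts, x => (ts (x i)).eval x

/-- The cost of a decision tree on an input: the number of queries made. -/
def DTree.cost {n M : ℕ} : DTree n M → (Fin n → Fin M) → ℕ
  | .leaf _, _ => 0
  | .node i ts, x => (ts (x i)).cost x + 1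

/-- The depth of a decision tree: its maximum cost over all inputs. -/
def DTree.depth {n M : ℕ} : DTree n M → ℕ
  | .leaf _ => 0
  | .node _ ts => (Finset.univ.sup fun a => (ts a).depth) + 1

/-- The tree `t` computes `f` on the promise `X`. -/
def Computes {n M : ℕ} (X : Set (Fin n → Fin M)) (f : (Fin n → Fin M) → Bool)
    (t : DTree n M) : Prop :=
  ∀ x ∈ X, t.eval x = f x

/-- The deterministic query complexity `D(f)`:
the least depth of a decision tree computing `f`. -/
noncomputable def detD {n M : ℕ} (X : Set (Fin n → Fin M))
    (f : (Fin n → Fin M) → Bool) : ℕ :=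
  sInf {d | ∃ t : DTree n M, Computes X f t ∧ t.depth = d}

/-- A finitely supported probability distribution over decision trees,
given as a finite list of trees with probabilities. -/
structure RandAlg (n M : ℕ) where
  N : ℕ
  tree : Fin N → DTree n M
  prob : Fin N → ℝ
  nonneg : ∀ j, 0 ≤ prob j
  sum_one : ∑ j, prob j = 1

/-- The expected cost of a randomized algorithm on the input `x`. -/
noncomputable def expCost {n M : ℕ} (A : RandAlg n M) (x : Fin n → Fin M) : ℝ :=
  ∑ j, A.prob j * ((A.tree j).cost x : ℝ)

/-- `A` is a zero-error randomized algorithm for `f`: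
every tree in its support computes `f`. -/
def ZeroError {n M : ℕ} (X : Set (Fin n → Fin M)) (f : (Fin n → Fin M) → Bool)
    (A : RandAlg n M) : Prop :=
  ∀ j, A.prob j ≠ 0 → Computes X f (A.tree j)

/-- The cost of a randomized algorithm: the maximum over inputs in the promise of
the expected cost. -/
noncomputable def algCost {n M : ℕ} (X : Set (Fin n → Fin M)) (A : RandAlg n M) : ℝ :=
  sSup {r | ∃ x ∈ X, r = expCost A x}

/-- The zero-error randomized query complexity `R₀(f)`:
the infimum cost of a zero-error randomized algorithm for `f`. -/
noncomputable def R0 {n M : ℕ} (X : Set (Fin n → Fin M))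
    (f : (Fin n → Fin M) → Bool) : ℝ :=
  sInf {r | ∃ A : RandAlg n M, ZeroError X f A ∧ algCost X A = r}

/-- `A` is a bounded-error randomized algorithm for `f`: on every input in the promise,
it returns the correct answer with probability at least 2/3. -/
def BoundedError {n M : ℕ} (X : Set (Fin n → Fin M)) (f : (Fin n → Fin M) → Bool)
    (A : RandAlg n M) : Prop :=
  ∀ x ∈ X, (2/3 : ℝ) ≤ ∑ j ∈ Finset.univ.filter fun j => (A.tree j).eval x = f x, A.prob j

/-- The depth of a randomized algorithm: the maximum depth of a tree in its support. -/
noncomputable def suppDepth {n M : ℕ} (A : RandAlg n M) : ℕ :=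
  (Finset.univ.filter fun j => A.prob j ≠ 0).sup fun j => (A.tree j).depth

/-- The bounded-error randomized query complexity `R(f)`:
the least depth of a bounded-error randomized algorithm for `f`. -/
noncomputable def randR {n M : ℕ} (X : Set (Fin n → Fin M))
    (f : (Fin n → Fin M) → Bool) : ℕ :=
  sInf {d | ∃ A : RandAlg n M, BoundedError X f A ∧ suppDepth A = d}

/-- A set of inputs is symmetric if it is invariant under permuting coordinates. -/
def SymmetricSet {n M : ℕ} (X : Set (Fin n → Fin M)) : Prop :=
  ∀ x ∈ X, ∀ σ : Equiv.Perm (Fin n), (x ∘ σ) ∈ X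

/-- A function is symmetric if its value depends only on the type of the input. -/
def SymmetricFun {n M : ℕ} (X : Set (Fin n → Fin M))
    (f : (Fin n → Fin M) → Bool) : Prop :=
  ∀ x ∈ X, ∀ y ∈ X, typeOf x = typeOf y → f x = f y

/-- The measure `d(f)` for a non-constant symmetric function: the least distance between
the types of two inputs in the promise with different values under `f`. -/
noncomputable def dgap {n M : ℕ} (X : Set (Fin n → Fin M))
    (f : (Fin n → Fin M) → Bool) : ℕ :=
  sInf {d | ∃ x ∈ X, ∃ y ∈ X, f x ≠ f y ∧
    (Finset.univ.sup fun a => Nat.dist (mult x a) (mult y a)) = d}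

variable {n M : ℕ}

/-- The set of positions read by a decision tree on an input. -/
def DTree.queried : DTree n M → (Fin n → Fin M) → Finset (Fin n)
  | .leaf _, _ => ∅
  | .node i ts, x => insert i ((ts (x i)).queried x)

lemma DTree.card_queried_le_cost (t : DTree n M) (x : Fin n → Fin M) :
    (t.queried x).card ≤ t.cost x := by
  induction t with
  | leaf b => simp [DTree.queried]
  | node i ts ih =>
    exact (Finset.card_insert_le _ _).trans (Nat.add_le_add_right (ih (x i)) 1)

lemma DTree.eval_eq_of_eqOn_queried (t : DTree n M) {x y : Fin n → Fin M}
    (h : ∀ i ∈ t.queried x, y i = x i) : t.eval y = t.eval x := by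
  induction t with
  | leaf b => rfl
  | node i ts ih =>
    have hi : y i = x i := h i (Finset.mem_insert_self _ _)
    simp only [DTree.eval, hi]
    exact ih (x i) fun j hj => h j (Finset.mem_insert_of_mem hj)

/-- The inputs of the promise `T` that agree with `z` on the positions `P`. -/
noncomputable def cylinder (T : Set (Fin n → Fin M)) (P : Finset (Fin n))
    (z : Fin n → Fin M) : Finset (Fin n → Fin M) :=
  Finset.univ.filter fun x => x ∈ T ∧ ∀ i ∈ P, x i = z i

lemma mem_cylinder {T : Set (Fin n → Fin M)} {P : Finset (Fin n)} {x z : Fin n → Fin M} :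
    x ∈ cylinder T P z ↔ x ∈ T ∧ ∀ i ∈ P, x i = z i := by
  simp [cylinder]

/-- The positions `Q` with their values in `x` certify the value `f x` on `T`. -/
def Certifies (T : Set (Fin n → Fin M)) (f : (Fin n → Fin M) → Bool)
    (x : Fin n → Fin M) (Q : Finset (Fin n)) : Prop :=
  ∀ y ∈ T, (∀ i ∈ Q, y i = x i) → f y = f x

lemma Computes.certifies_queried {T : Set (Fin n → Fin M)} {f : (Fin n → Fin M) → Bool}
    {t : DTree n M} (h : Computes T f t) {x : Fin n → Fin M} (hx : x ∈ T) :
    Certifies T f x (t.queried x) := fun y hy hyx => by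
  rw [← h y hy, ← h x hx, t.eval_eq_of_eqOn_queried hyx]

lemma typeOf_comp_perm (x : Fin n → Fin M) (σ : Equiv.Perm (Fin n)) :
    typeOf (x ∘ σ) = typeOf x := by
  unfold typeOf
  rw [← Multiset.map_map, Multiset.map_univ_val_equiv]

lemma count_typeOf (x : Fin n → Fin M) (a : Fin M) : (typeOf x).count a = mult x a := by
  unfold typeOf mult
  rw [Multiset.count_map, Finset.card_def, Finset.filter_val]
  simp only [eq_comm]

lemma IsTypePromise.nonempty {T : Set (Fin n → Fin M)} (hT : IsTypePromise T) :
    T.Nonempty := by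
  obtain ⟨x₀, rfl⟩ := hT
  exact ⟨x₀, rfl⟩

lemma IsTypePromise.symmetricSet {T : Set (Fin n → Fin M)} (hT : IsTypePromise T) :
    SymmetricSet T := by
  obtain ⟨x₀, rfl⟩ := hT
  intro x hx σ
  exact (typeOf_comp_perm x σ).trans hx

lemma IsTypePromise.mult_eq {T : Set (Fin n → Fin M)} (hT : IsTypePromise T)
    {x y : Fin n → Fin M} (hx : x ∈ T) (hy : y ∈ T) (a : Fin M) : mult x a = mult y a := by
  obtain ⟨x₀, rfl⟩ := hT
  rw [← count_typeOf, ← count_typeOf, (hx : typeOf x = _), (hy : typeOf y = _)]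

/-- A partial assignment that does not exceed any multiplicity of `y` extends to a
rearrangement of `y`. -/
lemma exists_perm_extending (y g : Fin n → Fin M) (W : Finset (Fin n))
    (h : ∀ a, (W.filter fun i => g i = a).card ≤ mult y a) :
    ∃ σ : Equiv.Perm (Fin n), ∀ i ∈ W, (y ∘ σ) i = g i := by
  have emb : ∀ a, ∃ e : Fin n → Fin n,
      (∀ i ∈ W.filter fun i => g i = a, y (e i) = a) ∧
      Set.InjOn e (W.filter fun i => g i = a : Finset (Fin n)) := by
    intro a
    obtain ⟨e⟩ := Function.Embedding.nonempty_of_card_le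
      (α := W.filter fun i => g i = a) (β := Finset.univ.filter fun i => y i = a)
      (by simpa only [Fintype.card_coe, mult] using h a)
    refine ⟨fun i => if hi : i ∈ W.filter fun i => g i = a then e ⟨i, hi⟩ else i,
      fun i hi => ?_, fun i hi j hj hij => ?_⟩
    · simpa only [dif_pos hi] using (Finset.mem_filter.1 (e ⟨i, hi⟩).2).2
    · rw [Finset.mem_coe] at hi hj
      simp only [dif_pos hi, dif_pos hj] at hij
      simpa using e.injective (Subtype.ext hij)
  choose e he hinj using emb
  obtain ⟨σ, hσ⟩ := Finset.exists_equiv_extend_of_card_eq (α := Fin n) (β := Fin n)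
    (t := Finset.univ) (by simp) (s := W) (f := fun i => e (g i) i) (by simp) (by
      intro i hi j hj hij
      have hi' := he (g i) i (by simpa using hi)
      have hj' := he (g j) j (by simpa using hj)
      simp only at hij
      have hg : g i = g j := by rw [← hi', ← hj', hij]
      refine hinj (g i) (by simpa using hi) (by simpa [hg] using hj) ?_
      rw [hij, hg])
  refine ⟨σ.trans (Equiv.subtypeUnivEquiv fun i => Finset.mem_univ i), fun i hi => ?_⟩
  have := hσ i hi
  simp only [Function.comp, Equiv.trans_apply, Equiv.subtypeUnivEquiv_apply, this]
  exact he (g i) i (by simpa using hi)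

lemma card_cylinder_letter_le {T : Set (Fin n → Fin M)} (hT : SymmetricSet T)
    (L : Finset (Fin M)) (l : ℕ)
    (hl : ∀ x ∈ T, (Finset.univ.filter fun i => x i ∈ L).card ≤ l)
    (P : Finset (Fin n)) (z : Fin n → Fin M) {i : Fin n} (hi : i ∉ P) :
    (n - P.card) * ((cylinder T P z).filter fun x => x i ∈ L).card
      ≤ l * (cylinder T P z).card := by
  have hswap : ∀ j ∈ Pᶜ, ((cylinder T P z).filter fun x => x i ∈ L).card
      = ((cylinder T P z).filter fun x => x j ∈ L).card := by
    intro j hj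
    rw [Finset.mem_compl] at hj
    have hfix : ∀ k ∈ P, Equiv.swap i j k = k := fun k hk =>
      Equiv.swap_apply_of_ne_of_ne (fun h => hi (h ▸ hk)) (fun h => hj (h ▸ hk))
    refine Finset.card_bij' (fun x _ => x ∘ Equiv.swap i j) (fun x _ => x ∘ Equiv.swap i j)
      ?_ ?_ ?_ ?_
    · intro x hx
      simp only [Finset.mem_filter, mem_cylinder, Function.comp] at hx ⊢
      refine ⟨⟨hT x hx.1.1 _, fun k hk => ?_⟩, ?_⟩
      · rw [hfix k hk, hx.1.2 k hk]
      · simpa using hx.2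
    · intro x hx
      simp only [Finset.mem_filter, mem_cylinder, Function.comp] at hx ⊢
      refine ⟨⟨hT x hx.1.1 _, fun k hk => ?_⟩, ?_⟩
      · rw [hfix k hk, hx.1.2 k hk]
      · simpa using hx.2
    · intro x _
      funext k
      simp
    · intro x _
      funext k
      simp
  calc (n - P.card) * ((cylinder T P z).filter fun x => x i ∈ L).card
      = ∑ j ∈ Pᶜ, ((cylinder T P z).filter fun x => x j ∈ L).card := by
        rw [← Finset.sum_congr rfl hswap, Finset.sum_const, Finset.card_compl,
          Fintype.card_fin, smul_eq_mul]
    _ = ∑ x ∈ cylinder T P z, (Pᶜ.filter fun j => x j ∈ L).card := by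
        simp only [Finset.card_filter]
        exact Finset.sum_comm
    _ ≤ ∑ _x ∈ cylinder T P z, l := by
        refine Finset.sum_le_sum fun x hx => ?_
        exact (Finset.card_le_card (Finset.filter_subset_filter _ (Finset.subset_univ _))).trans
          (hl x (mem_cylinder.1 hx).1)
    _ = l * (cylinder T P z).card := by
        rw [Finset.sum_const, smul_eq_mul, mul_comm]

lemma filter_cylinder_eq {T : Set (Fin n → Fin M)} {P : Finset (Fin n)}
    {z z' : Fin n → Fin M} (hz' : z' ∈ cylinder T P z) (i : Fin n) :
    ((cylinder T P z).filter fun x => x i = z' i) = cylinder T (insert i P) z' := by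
  ext x
  simp only [Finset.mem_filter, mem_cylinder, Finset.forall_mem_insert] at hz' ⊢
  constructor
  · rintro ⟨⟨hx, hP⟩, hi⟩
    exact ⟨hx, hi, fun k hk => (hP k hk).trans (hz'.2 k hk).symm⟩
  · rintro ⟨hx, hi, hP⟩
    exact ⟨⟨hx, fun k hk => (hP k hk).trans (hz'.2 k hk)⟩, hi⟩

/-- Among the inputs of a cylinder, few let a tree read a letter of `L` outside `P`
within `s` queries. -/
lemma card_reads_letter_le {T : Set (Fin n → Fin M)} (hT : SymmetricSet T)
    (L : Finset (Fin M)) (l N : ℕ)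
    (hl : ∀ x ∈ T, (Finset.univ.filter fun i => x i ∈ L).card ≤ l)
    (t : DTree n M) : ∀ (s : ℕ) (P : Finset (Fin n)) (z : Fin n → Fin M),
    P.card + s + N ≤ n →
    N * ((cylinder T P z).filter fun x =>
      t.cost x ≤ s ∧ ∃ i ∈ t.queried x, i ∉ P ∧ x i ∈ L).card
      ≤ s * l * (cylinder T P z).card := by
  induction t with
  | leaf b => intro s P z _; simp [DTree.queried]
  | node i ts ih =>
    intro s P z hs
    rcases s with _ | s
    · simp [DTree.cost]
    set C := cylinder T P z with hC
    set A := C.filter fun x => i ∉ P ∧ x i ∈ L with hA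
    set B := C.filter fun x => (ts (x i)).cost x ≤ s ∧
      ∃ j ∈ (ts (x i)).queried x, j ∉ insert i P ∧ x j ∈ L with hB
    have hsub : (C.filter fun x => (DTree.node i ts).cost x ≤ s + 1 ∧
        ∃ j ∈ (DTree.node i ts).queried x, j ∉ P ∧ x j ∈ L) ⊆ A ∪ B := by
      intro x hx
      simp only [Finset.mem_filter, DTree.cost, DTree.queried, add_le_add_iff_right] at hx
      obtain ⟨hxC, hc, j, hj, hjP, hjL⟩ := hx
      by_cases hij : j = i
      · subst hij
        exact Finset.mem_union_left _ (Finset.mem_filter.2 ⟨hxC, hjP, hjL⟩)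
      · refine Finset.mem_union_right _ (Finset.mem_filter.2 ⟨hxC, hc, j, ?_, ?_, hjL⟩)
        · exact (Finset.mem_insert.1 hj).resolve_left hij
        · simp [hij, hjP]
    have hAle : N * A.card ≤ l * C.card := by
      by_cases hi : i ∈ P
      · simp [hA, hi]
      · have := card_cylinder_letter_le hT L l hl P z hi
        simp only [hA, hi, not_false_eq_true, true_and]
        refine le_trans (Nat.mul_le_mul_right _ ?_) this
        omega
    have hBle : N * B.card ≤ s * l * C.card := by
      rw [Finset.card_eq_sum_card_fiberwise (s := B) (f := fun x => x i) (t := Finset.univ)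
          (fun _ _ => Finset.mem_univ _),
        Finset.card_eq_sum_card_fiberwise (s := C) (f := fun x => x i) (t := Finset.univ)
          (fun _ _ => Finset.mem_univ _), Finset.mul_sum, Finset.mul_sum]
      refine Finset.sum_le_sum fun a _ => ?_
      rcases (C.filter fun x => x i = a).eq_empty_or_nonempty with he | ⟨z', hz'⟩
      · have : (B.filter fun x => x i = a) = ∅ := by
          rw [← Finset.subset_empty, ← he]
          exact Finset.filter_subset_filter _ (Finset.filter_subset _ _)
        simp [this]
      · obtain ⟨hz'C, rfl⟩ := Finset.mem_filter.1 hz'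
        have hcard : (insert i P).card + s + N ≤ n := by
          have := Finset.card_insert_le i P
          omega
        refine le_trans (Nat.mul_le_mul_left _ (Finset.card_le_card ?_))
          ((ih (z' i) s (insert i P) z' hcard).trans_eq ?_)
        · intro x hx
          simp only [hB, Finset.mem_filter] at hx
          obtain ⟨⟨hxC, hc, hq⟩, hxi⟩ := hx
          rw [hxi] at hc hq
          refine Finset.mem_filter.2 ⟨?_, hc, hq⟩
          rw [← filter_cylinder_eq hz'C i]
          exact Finset.mem_filter.2 ⟨hxC, hxi⟩
        · rw [← filter_cylinder_eq hz'C i]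
    calc _ ≤ N * (A.card + B.card) :=
          Nat.mul_le_mul_left _ ((Finset.card_le_card hsub).trans (Finset.card_union_le _ _))
      _ ≤ l * C.card + s * l * C.card := by rw [mul_add]; exact add_le_add hAle hBle
      _ = (s + 1) * l * C.card := by ring

/-- Averaged over any nonempty family of inputs, some correct tree is as cheap as `K`. -/
def CheapOnAverage (T : Set (Fin n → Fin M)) (f : (Fin n → Fin M) → Bool) (K : ℕ) : Prop :=
  ∀ S : Finset (Fin n → Fin M), (∀ x ∈ S, x ∈ T) →
    ∃ t : DTree n M, Computes T f t ∧ ∑ x ∈ S, t.cost x ≤ K * S.card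

lemma expCost_le_algCost {T : Set (Fin n → Fin M)} (A : RandAlg n M) {x : Fin n → Fin M}
    (hx : x ∈ T) : expCost A x ≤ algCost T A := by
  refine le_csSup (Set.Finite.bddAbove ?_) ⟨x, hx, rfl⟩
  refine (Set.toFinite (Set.range (expCost A))).subset ?_
  rintro r ⟨y, _, rfl⟩
  exact ⟨y, rfl⟩

lemma ZeroError.cheapOnAverage {T : Set (Fin n → Fin M)} {f : (Fin n → Fin M) → Bool}
    {A : RandAlg n M} (hA : ZeroError T f A) {K : ℕ} (hK : algCost T A ≤ K) :
    CheapOnAverage T f K := by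
  intro S hS
  by_contra! hcon
  have hlt : ∀ j, A.prob j ≠ 0 → (K * S.card : ℝ) < ∑ x ∈ S, ((A.tree j).cost x : ℝ) :=
    fun j hj => by exact_mod_cast hcon _ (hA j hj)
  obtain ⟨j, hj⟩ : ∃ j, A.prob j ≠ 0 := by
    by_contra! h0
    simpa [h0] using A.sum_one
  have hle : ∑ j, A.prob j * ∑ x ∈ S, ((A.tree j).cost x : ℝ) ≤ K * S.card := by
    calc ∑ j, A.prob j * ∑ x ∈ S, ((A.tree j).cost x : ℝ) = ∑ x ∈ S, expCost A x := by
          simp only [expCost, Finset.mul_sum]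
          exact Finset.sum_comm
      _ ≤ ∑ _x ∈ S, (K : ℝ) :=
          Finset.sum_le_sum fun x hx => (expCost_le_algCost A (hS x hx)).trans hK
      _ = K * S.card := by rw [Finset.sum_const, nsmul_eq_mul, mul_comm]
  have hgt : ∑ j, A.prob j * (K * S.card : ℝ)
      < ∑ j, A.prob j * ∑ x ∈ S, ((A.tree j).cost x : ℝ) := by
    refine Finset.sum_lt_sum (fun k _ => ?_) ⟨j, Finset.mem_univ _, ?_⟩
    · by_cases hk : A.prob k = 0
      · simp [hk]
      · exact mul_le_mul_of_nonneg_left (hlt k hk).le (A.nonneg k)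
    · exact mul_lt_mul_of_pos_left (hlt j hj) (lt_of_le_of_ne (A.nonneg j) hj.symm)
  rw [← Finset.sum_mul, A.sum_one, one_mul] at hgt
  linarith

lemma CheapOnAverage.exists_certificate {T : Set (Fin n → Fin M)}
    {f : (Fin n → Fin M) → Bool} {K : ℕ} (h : CheapOnAverage T f K) {x : Fin n → Fin M}
    (hx : x ∈ T) : ∃ Q : Finset (Fin n), Q.card ≤ K ∧ Certifies T f x Q := by
  obtain ⟨t, ht, hc⟩ := h {x} (by simpa using hx)
  exact ⟨t.queried x, (t.card_queried_le_cost x).trans (by simpa using hc),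
    ht.certifies_queried hx⟩

/-- Every cylinder of small codimension contains an input with a short certificate that
avoids a given small set of letters at the new positions. -/
lemma CheapOnAverage.exists_certificate_avoiding {T : Set (Fin n → Fin M)}
    (hT : SymmetricSet T) {f : (Fin n → Fin M) → Bool} {K : ℕ} (h : CheapOnAverage T f K)
    (L : Finset (Fin M)) (l : ℕ)
    (hl : ∀ x ∈ T, (Finset.univ.filter fun i => x i ∈ L).card ≤ l)
    (P : Finset (Fin n)) {z : Fin n → Fin M} (hz : z ∈ T)
    (hn : P.card + 2 * K + (4 * K * l + 1) ≤ n) :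
    ∃ x ∈ cylinder T P z, ∃ Q : Finset (Fin n), Q.card ≤ 2 * K ∧ Certifies T f x Q ∧
      ∀ i ∈ Q, i ∉ P → x i ∉ L := by
  set C := cylinder T P z with hC
  have hCpos : 0 < C.card := Finset.card_pos.2 ⟨z, mem_cylinder.2 ⟨hz, fun _ _ => rfl⟩⟩
  obtain ⟨t, ht, hc⟩ := h C fun x hx => (mem_cylinder.1 hx).1
  have hbad := card_reads_letter_le hT L l (4 * K * l + 1) hl t (2 * K) P z hn
  rw [← hC] at hbad
  set B := C.filter fun x => t.cost x ≤ 2 * K ∧ ∃ i ∈ t.queried x, i ∉ P ∧ x i ∈ L with hB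
  set E := C.filter fun x => ¬ t.cost x ≤ 2 * K with hE
  have hE2 : 2 * E.card < C.card := by
    have h1 : E.card * (2 * K + 1) ≤ K * C.card := by
      calc E.card * (2 * K + 1) = ∑ _x ∈ E, (2 * K + 1) := by simp
        _ ≤ ∑ x ∈ E, t.cost x := Finset.sum_le_sum fun x hx => by
            have := (Finset.mem_filter.1 hx).2
            omega
        _ ≤ ∑ x ∈ C, t.cost x :=
            Finset.sum_le_sum_of_subset (Finset.filter_subset _ _)
        _ ≤ K * C.card := hc
    by_contra! hcon
    nlinarith
  have hB2 : 2 * B.card ≤ C.card := by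
    by_contra! hcon
    have : (4 * K * l + 1) * C.card < (4 * K * l + 1) * (2 * B.card) :=
      Nat.mul_lt_mul_of_pos_left hcon (by omega)
    nlinarith
  obtain ⟨x, hxC, hx⟩ : ∃ x ∈ C, x ∉ E ∪ B := by
    by_contra! hcon
    have := (Finset.card_le_card (show C ⊆ E ∪ B from hcon)).trans (Finset.card_union_le _ _)
    omega
  simp only [hE, hB, Finset.mem_union, Finset.mem_filter, hxC, true_and, not_or,
    not_not] at hx
  obtain ⟨hcost, hx⟩ := hx
  refine ⟨x, hxC, t.queried x, (t.card_queried_le_cost x).trans hcost,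
    ht.certifies_queried (mem_cylinder.1 hxC).1, fun i hi hiP hiL => hx ⟨hcost, i, hi, hiP, hiL⟩⟩

/-- Certificates of inputs with different values either disagree at a position or
compete for a letter. -/
lemma Certifies.exists_conflict {T : Set (Fin n → Fin M)} (hT : IsTypePromise T)
    {f : (Fin n → Fin M) → Bool} {P Q Q' : Finset (Fin n)} {x y : Fin n → Fin M}
    (hx : x ∈ T) (hy : y ∈ T) (hxy : f x ≠ f y) (hP : ∀ i ∈ P, x i = y i)
    (hQ : Certifies T f x Q) (hQ' : Certifies T f y Q') :
    (∃ i ∈ Q, i ∈ Q' ∧ i ∉ P) ∨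
    ∃ i ∈ Q, i ∉ P ∧ x i ∈ Q'.image y ∧ mult x (x i) ≤ Q.card + Q'.card := by
  by_contra! hcon
  obtain ⟨hpos, hlet⟩ := hcon
  have hagree : ∀ i ∈ Q, i ∈ Q' → y i = x i := fun i hi hi' => (hP i (hpos i hi hi')).symm
  set g : Fin n → Fin M := fun i => if i ∈ Q' then y i else x i with hg
  have hcount : ∀ a, ((Q ∪ Q').filter fun i => g i = a).card ≤ mult y a := by
    intro a
    by_contra! hlt
    have hex : ∃ i ∈ Q, i ∉ P ∧ x i = a := by
      by_contra! hno
      refine hlt.not_ge (Finset.card_le_card fun i hi => ?_)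
      simp only [Finset.mem_filter, Finset.mem_union, hg, Finset.mem_univ, true_and] at hi ⊢
      obtain ⟨hi, hia⟩ := hi
      split_ifs at hia with hiQ'
      · exact hia
      · have hiQ := hi.resolve_right hiQ'
        by_cases hiP : i ∈ P
        · rw [← hP i hiP, hia]
        · exact absurd hia (hno i hiQ hiP)
    have hmem : a ∈ Q'.image y := by
      by_contra hno
      refine hlt.not_ge ?_
      rw [← hT.mult_eq hx hy]
      refine Finset.card_le_card fun i hi => ?_
      simp only [Finset.mem_filter, Finset.mem_univ, true_and, hg] at hi ⊢
      obtain ⟨hi, hia⟩ := hi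
      split_ifs at hia with hiQ'
      · exact absurd (Finset.mem_image.2 ⟨i, hiQ', hia⟩) hno
      · exact hia
    obtain ⟨i, hiQ, hiP, rfl⟩ := hex
    have h1 := hlet i hiQ hiP hmem
    have h2 := (Finset.card_filter_le (Q ∪ Q') fun j => g j = x i).trans
      (Finset.card_union_le Q Q')
    rw [hT.mult_eq hx hy] at h1
    omega
  obtain ⟨σ, hσ⟩ := exists_perm_extending y g (Q ∪ Q') hcount
  have hw := hT.symmetricSet y hy σ
  refine hxy ((hQ _ hw fun i hi => ?_).symm.trans (hQ' _ hw fun i hi => ?_))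
  · rw [hσ i (Finset.mem_union_left _ hi)]
    by_cases hi' : i ∈ Q'
    · simp [hg, hi', hagree i hi hi']
    · simp [hg, hi']
  · rw [hσ i (Finset.mem_union_right _ hi)]
    simp [hg, hi]

/-- Reading all positions of `Q` costs `Q.card` queries. -/
lemma exists_tree_of_read {T : Set (Fin n → Fin M)} {f : (Fin n → Fin M) → Bool} (d : ℕ)
    (Q : Finset (Fin n)) : ∀ (P : Finset (Fin n)) (z : Fin n → Fin M),
    (∀ z' ∈ cylinder T P z, ∃ t : DTree n M, t.depth ≤ d ∧
      Computes (cylinder T (P ∪ Q) z' : Set (Fin n → Fin M)) f t) →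
    ∃ t : DTree n M, t.depth ≤ d + Q.card ∧
      Computes (cylinder T P z : Set (Fin n → Fin M)) f t := by
  induction Q using Finset.induction_on with
  | empty =>
    intro P z h
    by_cases hne : (cylinder T P z).Nonempty
    · obtain ⟨z', hz'⟩ := hne
      obtain ⟨t, ht, hc⟩ := h z' hz'
      refine ⟨t, by simpa using ht, fun x hx => hc x ?_⟩
      simp only [Finset.mem_coe, mem_cylinder, Finset.union_empty] at hx hz' ⊢
      exact ⟨hx.1, fun i hi => (hx.2 i hi).trans (hz'.2 i hi).symm⟩
    · refine ⟨.leaf true, by simp [DTree.depth], fun x hx => absurd ⟨x, hx⟩ hne⟩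
  | insert i Q hi ih =>
    intro P z h
    have hsub : ∀ a, ∃ t : DTree n M, t.depth ≤ d + Q.card ∧
        Computes {x | x ∈ cylinder T P z ∧ x i = a} f t := by
      intro a
      by_cases hne : ∃ z', z' ∈ cylinder T P z ∧ z' i = a
      · obtain ⟨z', hz', rfl⟩ := hne
        obtain ⟨t, ht, hc⟩ := ih (insert i P) z' (by
          intro w hw
          rw [← filter_cylinder_eq hz' i] at hw
          have := h w (Finset.mem_filter.1 hw).1
          rwa [Finset.union_insert, ← Finset.insert_union] at this)
        refine ⟨t, ht, fun x hx => hc x ?_⟩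
        rw [← filter_cylinder_eq hz' i]
        exact Finset.mem_coe.2 (Finset.mem_filter.2 hx)
      · exact ⟨.leaf true, by simp [DTree.depth], fun x hx => absurd ⟨x, hx⟩ hne⟩
    choose ts hts hc using hsub
    refine ⟨.node i ts, ?_, fun x hx => hc (x i) x ⟨hx, rfl⟩⟩
    rw [Finset.card_insert_of_notMem hi, ← add_assoc]
    exact Nat.add_le_add_right (Finset.sup_le fun a _ => hts a) 1

lemma exists_tree_depth_le (T : Set (Fin n → Fin M)) (f : (Fin n → Fin M) → Bool) :
    ∃ t : DTree n M, t.depth ≤ n ∧ Computes T f t := by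
  by_cases hne : T.Nonempty
  · obtain ⟨z, _⟩ := hne
    obtain ⟨t, ht, hc⟩ := exists_tree_of_read (T := T) (f := f) 0 Finset.univ ∅ z fun z' _ =>
      ⟨.leaf (f z'), le_rfl, fun x hx => by
        have : x = z' := funext fun i => (mem_cylinder.1 hx).2 i (by simp)
        rw [this]; rfl⟩
    refine ⟨t, by simpa using ht, fun x hx => hc x ?_⟩
    exact Finset.mem_coe.2 (mem_cylinder.2 ⟨hx, by simp⟩)
  · exact ⟨.leaf true, by simp [DTree.depth], fun x hx => absurd ⟨x, hx⟩ hne⟩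

/-- Every short certificate of an input of value other than `b` in the cylinder meets `P`
and `L` at least `u` times in total. -/
def Exhausted (T : Set (Fin n → Fin M)) (f : (Fin n → Fin M) → Bool) (K : ℕ)
    (P : Finset (Fin n)) (z : Fin n → Fin M) (L : Finset (Fin M)) (b : Bool) (u : ℕ) : Prop :=
  ∀ y ∈ cylinder T P z, f y ≠ b → ∀ Q : Finset (Fin n), Q.card ≤ K → Certifies T f y Q →
    u ≤ (Q ∩ P).card + (Q.image y ∩ L).card

lemma Exhausted.eq_of_lt {T : Set (Fin n → Fin M)} {f : (Fin n → Fin M) → Bool} {K : ℕ}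
    (h : CheapOnAverage T f K) {P : Finset (Fin n)} {z : Fin n → Fin M} {L : Finset (Fin M)}
    {b : Bool} {u : ℕ} (hex : Exhausted T f K P z L b u) (hu : 2 * K < u)
    {y : Fin n → Fin M} (hy : y ∈ cylinder T P z) : f y = b := by
  by_contra hne
  obtain ⟨Q, hQ, hc⟩ := h.exists_certificate (mem_cylinder.1 hy).1
  have h1 := hex y hy hne Q hQ hc
  have h2 := Finset.card_le_card (Finset.inter_subset_left (s₁ := Q) (s₂ := P))
  have h3 := Finset.card_le_card (Finset.inter_subset_left (s₁ := Q.image y) (s₂ := L))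
  have h4 := Finset.card_image_le (s := Q) (f := y)
  omega

/-- After `m` rounds of reading certificates that avoid previously used rare letters, the
value of the function is known. -/
lemma exists_tree_of_exhausted {T : Set (Fin n → Fin M)} (hT : IsTypePromise T)
    {f : (Fin n → Fin M) → Bool} {K : ℕ} (h : CheapOnAverage T f K) (B : ℕ)
    (hn : B + 2 * K + (4 * K * (3 * K * B) + 1) ≤ n) (m : ℕ) :
    ∀ (P : Finset (Fin n)) (z : Fin n → Fin M) (L : Finset (Fin M)) (u : Bool → ℕ), z ∈ T →
    P.card + 2 * K * m ≤ B → L.card + 2 * K * m ≤ B →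
    (∀ a ∈ L, ∀ x ∈ T, mult x a ≤ 3 * K) →
    (∀ b, Exhausted T f K P z L b (u b)) → 4 * K + 1 ≤ u false + u true + m →
    ∃ t : DTree n M, t.depth ≤ 2 * K * m ∧
      Computes (cylinder T P z : Set (Fin n → Fin M)) f t := by
  induction m with
  | zero =>
    intro P z L u _ _ _ _ hex hu
    obtain ⟨b, hb⟩ : ∃ b, 2 * K < u b := by
      by_contra! hno
      have := hno false
      have := hno true
      omega
    exact ⟨.leaf b, by simp [DTree.depth], fun y hy => ((hex b).eq_of_lt h hb hy).symm⟩
  | succ m ih =>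
    intro P z L u hz hP hL hrare hex hu
    have hLtok : ∀ x ∈ T, (Finset.univ.filter fun i => x i ∈ L).card ≤ 3 * K * B := by
      intro x hx
      rw [Finset.card_eq_sum_card_fiberwise (s := Finset.univ.filter fun i => x i ∈ L)
        (f := x) (t := L) fun i hi => (Finset.mem_filter.1 hi).2]
      calc _ ≤ ∑ _a ∈ L, 3 * K := Finset.sum_le_sum fun a ha =>
            (Finset.card_le_card (Finset.filter_subset_filter _ (Finset.subset_univ _))).trans
              (hrare a ha x hx)
        _ = 3 * K * L.card := by rw [Finset.sum_const, smul_eq_mul, mul_comm]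
        _ ≤ 3 * K * B := Nat.mul_le_mul_left _ (by omega)
    obtain ⟨x, hx, Q, hQ, hcert, havoid⟩ :=
      h.exists_certificate_avoiding hT.symmetricSet L (3 * K * B) hLtok P hz (by omega)
    have hxT := (mem_cylinder.1 hx).1
    set L' := L ∪ ((Q \ P).image x).filter fun a => mult x a ≤ 3 * K with hL'
    have hL'card : L'.card ≤ L.card + 2 * K := by
      have h1 := Finset.card_union_le L (((Q \ P).image x).filter fun a => mult x a ≤ 3 * K)
      have h2 := Finset.card_filter_le ((Q \ P).image x) fun a => mult x a ≤ 3 * K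
      have h3 := Finset.card_image_le (s := Q \ P) (f := x)
      have h4 := Finset.card_le_card (Finset.sdiff_subset (s := Q) (t := P))
      rw [← hL'] at h1
      omega
    have hPQ := Finset.card_union_le P Q
    have hmul : 2 * K * (m + 1) = 2 * K * m + 2 * K := by ring
    obtain ⟨t, ht, hc⟩ := exists_tree_of_read (T := T) (f := f) (2 * K * m) Q P z (by
      intro z' hz'
      have hz'T := mem_cylinder.1 hz'
      have hsub : ∀ y ∈ cylinder T (P ∪ Q) z', y ∈ cylinder T P z := fun y hy => by
        rw [mem_cylinder] at hy ⊢
        exact ⟨hy.1, fun i hi =>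
          (hy.2 i (Finset.mem_union_left _ hi)).trans (hz'T.2 i hi)⟩
      refine ih (P ∪ Q) z' L' (Function.update u (f x) (u (f x) + 1)) hz'T.1
        (by omega) (by omega) ?_ ?_ ?_
      · intro a ha w hw
        rcases Finset.mem_union.1 ha with ha | ha
        · exact hrare a ha w hw
        · rw [hT.mult_eq hw hxT]
          exact (Finset.mem_filter.1 ha).2
      · intro b y hy hyb Q' hQ' hcert'
        have hyC := hsub y hy
        have hold := hex b y hyC hyb Q' hQ' hcert'
        have hm1 : Q' ∩ P ⊆ Q' ∩ (P ∪ Q) :=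
          Finset.inter_subset_inter_left Finset.subset_union_left
        have hm2 : Q'.image y ∩ L ⊆ Q'.image y ∩ L' :=
          Finset.inter_subset_inter_left Finset.subset_union_left
        by_cases hb : b = f x
        · subst hb
          rw [Function.update_self]
          have hagree : ∀ i ∈ P, x i = y i := fun i hi =>
            ((mem_cylinder.1 hx).2 i hi).trans ((mem_cylinder.1 hyC).2 i hi).symm
          rcases hcert.exists_conflict hT hxT (mem_cylinder.1 hy).1 (Ne.symm hyb) hagree
            hcert' with ⟨i, hiQ, hiQ', hiP⟩ | ⟨i, hiQ, hiP, hiQ', hmult⟩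
          · have h1 : (Q' ∩ P).card < (Q' ∩ (P ∪ Q)).card :=
              Finset.card_lt_card ((Finset.ssubset_iff_of_subset hm1).2
                ⟨i, by simp [hiQ, hiQ'], by simp [hiP]⟩)
            have h2 := Finset.card_le_card hm2
            omega
          · have h1 := Finset.card_le_card hm1
            have h2 : (Q'.image y ∩ L).card < (Q'.image y ∩ L').card := by
              refine Finset.card_lt_card ((Finset.ssubset_iff_of_subset hm2).2 ⟨x i, ?_, ?_⟩)
              · refine Finset.mem_inter.2 ⟨hiQ', Finset.mem_union_right _
                  (Finset.mem_filter.2 ⟨Finset.mem_image_of_mem _ ?_, by omega⟩)⟩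
                exact Finset.mem_sdiff.2 ⟨hiQ, hiP⟩
              · exact fun hmem => havoid i hiQ hiP (Finset.mem_inter.1 hmem).2
            omega
        · rw [Function.update_of_ne hb]
          have h1 := Finset.card_le_card hm1
          have h2 := Finset.card_le_card hm2
          omega
      · cases f x <;> simp [Function.update] <;> omega)
    exact ⟨t, by omega, hc⟩

lemma detD_le {T : Set (Fin n → Fin M)} {f : (Fin n → Fin M) → Bool} {t : DTree n M} {d : ℕ}
    (ht : t.depth ≤ d) (hc : Computes T f t) : detD T f ≤ d :=
  le_trans (Nat.sInf_le (m := t.depth) ⟨t, hc, rfl⟩) ht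

lemma CheapOnAverage.detD_le {T : Set (Fin n → Fin M)} (hT : IsTypePromise T)
    {f : (Fin n → Fin M) → Bool} {K : ℕ} (hK : 1 ≤ K) (h : CheapOnAverage T f K)
    (hn : 133 * K ^ 4 ≤ n) : detD T f ≤ 10 * K ^ 2 := by
  obtain ⟨z, hz⟩ := hT.nonempty
  obtain ⟨t, ht, hc⟩ := exists_tree_of_exhausted hT h (2 * K * (4 * K + 1))
    (by
      have h1 : K ≤ K ^ 4 := Nat.le_self_pow (by norm_num) K
      have h2 : K ^ 2 ≤ K ^ 4 := Nat.pow_le_pow_right hK (by norm_num)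
      have h3 : K ^ 3 ≤ K ^ 4 := Nat.pow_le_pow_right hK (by norm_num)
      nlinarith)
    (4 * K + 1) ∅ z ∅ (fun _ => 0) hz (by simp) (by simp) (by simp)
    (fun b y _ _ Q _ _ => Nat.zero_le _) (by simp)
  refine QCPaper.detD_le (t := t) (ht.trans (by nlinarith)) fun x hx => hc x ?_
  exact Finset.mem_coe.2 (mem_cylinder.2 ⟨hx, by simp⟩)

lemma algCost_nonneg {T : Set (Fin n → Fin M)} (A : RandAlg n M) : 0 ≤ algCost T A := by
  refine Real.sSup_nonneg ?_
  rintro r ⟨x, _, rfl⟩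
  exact Finset.sum_nonneg fun j _ => mul_nonneg (A.nonneg j) (Nat.cast_nonneg _)

/-- An algorithm of cost less than one contains a tree that makes no query at all. -/
lemma ZeroError.one_le_algCost {T : Set (Fin n → Fin M)} {f : (Fin n → Fin M) → Bool}
    {A : RandAlg n M} (hA : ZeroError T f A) (hT : T.Nonempty) (hD : detD T f ≠ 0) :
    1 ≤ algCost T A := by
  obtain ⟨x, hx⟩ := hT
  refine le_trans ?_ (expCost_le_algCost A hx)
  rw [← A.sum_one]
  refine Finset.sum_le_sum fun j _ => ?_
  by_cases hj : A.prob j = 0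
  · simp [hj]
  refine le_mul_of_one_le_right (A.nonneg j) ?_
  have hc := hA j hj
  cases ht : A.tree j with
  | leaf b =>
    rw [ht] at hc
    exact absurd (Nat.le_zero.1 (detD_le (d := 0) (by simp [DTree.depth]) hc)) hD
  | node i ts => simp [DTree.cost]

lemma exists_zeroError (T : Set (Fin n → Fin M)) (f : (Fin n → Fin M) → Bool) :
    ∃ A : RandAlg n M, ZeroError T f A := by
  obtain ⟨t, _, hc⟩ := exists_tree_depth_le T f
  exact ⟨⟨1, fun _ => t, fun _ => 1, by simp, by simp⟩, fun _ _ => hc⟩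

/-- on any type promise, `R₀(f) ≥ c · min(D(f)^{1/2}, n^{1/4})`, and
consequently `R₀(f) ≥ c · D(f)^{1/4}`. -/
theorem R0_lower_bound_type : ∃ c : ℝ, 0 < c ∧
    ∀ (n M : ℕ), 1 ≤ n → 1 ≤ M →
    ∀ T : Set (Fin n → Fin M), IsTypePromise T →
    ∀ f : (Fin n → Fin M) → Bool,
      c * min ((detD T f : ℝ) ^ ((1 : ℝ) / 2)) ((n : ℝ) ^ ((1 : ℝ) / 4)) ≤ R0 T f ∧
      c * (detD T f : ℝ) ^ ((1 : ℝ) / 4) ≤ R0 T f := by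
  refine ⟨1 / 8, by norm_num, fun n M _ _ T hT f => ?_⟩
  have hmain : 1 / 8 * min ((detD T f : ℝ) ^ ((1 : ℝ) / 2)) ((n : ℝ) ^ ((1 : ℝ) / 4))
      ≤ R0 T f := by
    obtain ⟨A₀, hA₀⟩ := exists_zeroError T f
    refine le_csInf ⟨_, A₀, hA₀, rfl⟩ ?_
    rintro r ⟨A, hA, rfl⟩
    by_cases hD : detD T f = 0
    · refine le_trans (mul_nonpos_of_nonneg_of_nonpos (by norm_num) ?_) (algCost_nonneg A)
      refine (min_le_left _ _).trans_eq ?_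
      rw [hD, Nat.cast_zero, Real.zero_rpow (by norm_num)]
    have hr := hA.one_le_algCost hT.nonempty hD
    set r := algCost T A with hr_def
    have hcheap := hA.cheapOnAverage (Nat.le_ceil (algCost T A))
    rw [← hr_def] at hcheap
    set K := ⌈r⌉₊ with hK
    have hK1 : 1 ≤ K := Nat.one_le_ceil_iff.2 (by linarith)
    have hK2 : (K : ℝ) ≤ 2 * r := by
      have := Nat.ceil_lt_add_one (a := r) (by linarith)
      linarith
    rcases le_or_gt (133 * K ^ 4) n with hn | hn
    · have hd : (detD T f : ℝ) ≤ (8 * r) ^ 2 := by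
        have h1 : (detD T f : ℝ) ≤ 10 * (K : ℝ) ^ 2 := by
          exact_mod_cast hcheap.detD_le hT hK1 hn
        nlinarith [Nat.cast_nonneg (α := ℝ) K]
      have : (detD T f : ℝ) ^ ((1 : ℝ) / 2) ≤ 8 * r := by
        rw [← Real.sqrt_eq_rpow]
        exact Real.sqrt_le_iff.2 ⟨by linarith, hd⟩
      have := (min_le_left ((detD T f : ℝ) ^ ((1 : ℝ) / 2)) ((n : ℝ) ^ ((1 : ℝ) / 4))).trans this
      linarith
    · have hd : (n : ℝ) ≤ (8 * r) ^ 4 := by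
        have h1 : (n : ℝ) ≤ 133 * (K : ℝ) ^ 4 := by exact_mod_cast hn.le
        have h2 : (K : ℝ) ^ 4 ≤ (2 * r) ^ 4 := pow_le_pow_left₀ (Nat.cast_nonneg _) hK2 4
        have h3 : 0 ≤ r ^ 4 := by positivity
        nlinarith
      have : (n : ℝ) ^ ((1 : ℝ) / 4) ≤ 8 * r := by
        calc (n : ℝ) ^ ((1 : ℝ) / 4) ≤ ((8 * r) ^ 4) ^ ((1 : ℝ) / 4) :=
              Real.rpow_le_rpow (Nat.cast_nonneg _) hd (by norm_num)
          _ = 8 * r := by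
              rw [← Real.rpow_natCast, ← Real.rpow_mul (by linarith)]
              norm_num
      have := (min_le_right ((detD T f : ℝ) ^ ((1 : ℝ) / 2)) ((n : ℝ) ^ ((1 : ℝ) / 4))).trans this
      linarith
  refine ⟨hmain, le_trans (mul_le_mul_of_nonneg_left ?_ (by norm_num)) hmain⟩
  obtain ⟨t, ht, hc⟩ := exists_tree_depth_le T f
  have hDn : (detD T f : ℝ) ≤ n := by exact_mod_cast detD_le ht hc
  refine le_min ?_ (Real.rpow_le_rpow (Nat.cast_nonneg _) hDn (by norm_num))
  rcases Nat.eq_zero_or_pos (detD T f) with h0 | hpos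
  · rw [h0, Nat.cast_zero, Real.zero_rpow (by norm_num), Real.zero_rpow (by norm_num)]
  · exact Real.rpow_le_rpow_of_exponent_le (by exact_mod_cast hpos) (by norm_num)

end QCPaper
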